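/- Let G be a spray on an open set U ⊆ ℝⁿ (n ≥ 2) which is S-closed, i.e., there exist smooth functions η_k(x) on U with Π(x,y) = η_k(x) y^k and ∂η_k/∂x^l = ∂η_l/∂x^k for all k, l, where Π := ∂G^m/∂y^m. Then the χ-curvature of G vanishes: χ_k = 0 for all k. -/

import Mathlib

open scoped BigOperators

noncomputable section

/-- Points/vectors in local coordinates on an open subset of `ℝⁿ`. -/
abbrev Vec (n : ℕ) := Fin n → ℝ

variable {n : ℕ}

/-- Partial derivative in the base (`x`) variable, in the `k`-th coordinate direction. -/
noncomputable def pdx (f : Vec n → Vec n → ℝ) (k : Fin n) (x y : Vec n) : ℝ :=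
  fderiv ℝ (fun x' => f x' y) x (Pi.single k 1)

/-- Partial derivative in the fiber (`y`) variable, in the `k`-th coordinate direction;
this is the operation denoted by a subscript `·k`. -/
noncomputable def pdy (f : Vec n → Vec n → ℝ) (k : Fin n) (x y : Vec n) : ℝ :=
  fderiv ℝ (fun y' => f x y') y (Pi.single k 1)

/-- Partial derivative of a function of `x` alone. -/
noncomputable def pd (f : Vec n → ℝ) (k : Fin n) (x : Vec n) : ℝ :=
  fderiv ℝ f x (Pi.single k 1)

/-- `G` is a spray on the open set `U ⊆ ℝⁿ`: the coefficients `Gⁱ(x,y)` are smooth for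
`x ∈ U`, `y ≠ 0`, and positively homogeneous of degree `2` in `y`. -/
def IsSpray (U : Set (Vec n)) (G : Fin n → Vec n → Vec n → ℝ) : Prop :=
  (∀ i, ContDiffOn ℝ (⊤ : ℕ∞) (fun p : Vec n × Vec n => G i p.1 p.2)
      (U ×ˢ {y : Vec n | y ≠ 0})) ∧
  (∀ i (x y : Vec n) (lam : ℝ), 0 < lam → G i x (lam • y) = lam ^ 2 * G i x y)

/-- `N^i_j := ∂G^i/∂y^j`. -/
noncomputable def Nc (G : Fin n → Vec n → Vec n → ℝ) (i j : Fin n) (x y : Vec n) : ℝ :=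
  pdy (G i) j x y

/-- `Γ^i_{jk} := ∂²G^i/∂y^j∂y^k`. -/
noncomputable def Ga (G : Fin n → Vec n → Vec n → ℝ) (i j k : Fin n) (x y : Vec n) : ℝ :=
  pdy (Nc G i j) k x y

/-- The horizontal derivative `δf/δx^k := ∂f/∂x^k − N^m_k ∂f/∂y^m`; for a scalar `f` this is
also the horizontal covariant derivative `f_{|k}`. -/
noncomputable def hd (G : Fin n → Vec n → Vec n → ℝ) (f : Vec n → Vec n → ℝ)
    (k : Fin n) (x y : Vec n) : ℝ :=
  pdx f k x y - ∑ m, Nc G m k x y * pdy f m x y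

/-- The four-index Riemann curvature tensor
`R_j{}^i{}_{kl} := δΓⁱ_{jl}/δx^k − δΓⁱ_{jk}/δx^l + Γⁱ_{ks}Γ^s_{jl} − Γ^s_{jk}Γⁱ_{ls}`. -/
noncomputable def Riem4 (G : Fin n → Vec n → Vec n → ℝ) (j i k l : Fin n)
    (x y : Vec n) : ℝ :=
  hd G (Ga G i j l) k x y - hd G (Ga G i j k) l x y
    + ∑ s, (Ga G i k s x y * Ga G s j l x y - Ga G s j k x y * Ga G i l s x y)

/-- The two-index Riemann curvature `R^i_k := y^j R_j{}^i{}_{kl} y^l`. -/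
noncomputable def Riem2 (G : Fin n → Vec n → Vec n → ℝ) (i k : Fin n)
    (x y : Vec n) : ℝ :=
  ∑ j, ∑ l, y j * Riem4 G j i k l x y * y l

/-- The χ-curvature `χ_k := −(1/6)(2 R^m_{k·m} + R^m_{m·k})`. -/
noncomputable def chi (G : Fin n → Vec n → Vec n → ℝ) (k : Fin n) (x y : Vec n) : ℝ :=
  -(1 / 6) * (2 * ∑ m, pdy (Riem2 G m k) m x y + ∑ m, pdy (Riem2 G m m) k x y)

/-- The scalar `R := (1/(n−1)) R^m_m`. -/
noncomputable def Rsc (G : Fin n → Vec n → Vec n → ℝ) (x y : Vec n) : ℝ :=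
  (1 / ((n : ℝ) - 1)) * ∑ m, Riem2 G m m x y

/-- `Π := ∂G^m/∂y^m`. -/
noncomputable def PiG (G : Fin n → Vec n → Vec n → ℝ) (x y : Vec n) : ℝ :=
  ∑ m, Nc G m m x y

/-- The S-curvature of `(G, dV)` for the volume form `dV = σ(x) dx¹⋯dxⁿ`:
`S := Π − y^m ∂(ln σ)/∂x^m`. -/
noncomputable def Scurv (G : Fin n → Vec n → Vec n → ℝ) (σ : Vec n → ℝ)
    (x y : Vec n) : ℝ :=
  PiG G x y - ∑ m, y m * pd (fun x' => Real.log (σ x')) m x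

/-- The spray `Ĝ` associated with `(G, dV)`: `Ĝⁱ := Gⁱ − (S/(n+1)) yⁱ`. -/
noncomputable def Ghat (G : Fin n → Vec n → Vec n → ℝ) (σ : Vec n → ℝ)
    (i : Fin n) (x y : Vec n) : ℝ :=
  G i x y - (Scurv G σ x y / ((n : ℝ) + 1)) * y i

/-- `σ` is the (positive, smooth) density of a volume form `dV = σ(x) dx¹⋯dxⁿ` on `U`. -/
def IsVolumeForm (U : Set (Vec n)) (σ : Vec n → ℝ) : Prop :=
  ContDiffOn ℝ (⊤ : ℕ∞) σ U ∧ ∀ x ∈ U, 0 < σ x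

/-- `G` is of isotropic curvature on `U`: `Rⁱ_k = R δⁱ_k − (1/2) R_{·k} yⁱ`. -/
def IsIsotropicCurv (U : Set (Vec n)) (G : Fin n → Vec n → Vec n → ℝ) : Prop :=
  ∀ x ∈ U, ∀ y : Vec n, y ≠ 0 → ∀ i k,
    Riem2 G i k x y
      = Rsc G x y * (if i = k then 1 else 0) - (1 / 2) * pdy (Rsc G) k x y * y i

/-- `G` is of scalar curvature on `U`: `Rⁱ_k = R δⁱ_k − τ_k yⁱ` for some functions `τ_k`,
positively homogeneous of degree one in `y`, with `τ_k y^k = R`. -/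
def IsScalarCurv (U : Set (Vec n)) (G : Fin n → Vec n → Vec n → ℝ) : Prop :=
  ∃ τ : Fin n → Vec n → Vec n → ℝ,
    (∀ k (x y : Vec n) (lam : ℝ), 0 < lam → τ k x (lam • y) = lam * τ k x y) ∧
    ∀ x ∈ U, ∀ y : Vec n, y ≠ 0 →
      (∑ k, τ k x y * y k) = Rsc G x y ∧
      ∀ i k, Riem2 G i k x y
        = Rsc G x y * (if i = k then 1 else 0) - τ k x y * y i

/-- Smoothness of a function of `(x, y)` over `U`, away from the zero section. -/
def SmoothOffZero (U : Set (Vec n)) (f : Vec n → Vec n → ℝ) : Prop :=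
  ContDiffOn ℝ (⊤ : ℕ∞) (fun p : Vec n × Vec n => f p.1 p.2) (U ×ˢ {y : Vec n | y ≠ 0})

theorem isOpen_prod_ne_zero {U : Set (Vec n)} (hU : IsOpen U) :
    IsOpen (U ×ˢ {y : Vec n | y ≠ 0}) :=
  hU.prod isOpen_ne

theorem pdx_congr {U : Set (Vec n)} (hU : IsOpen U) {f g : Vec n → Vec n → ℝ}
    (h : ∀ x ∈ U, ∀ y, y ≠ 0 → f x y = g x y) (k : Fin n) :
    ∀ x ∈ U, ∀ y, y ≠ 0 → pdx f k x y = pdx g k x y := by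
  intro x hx y hy
  have : (fun x' => f x' y) =ᶠ[nhds x] fun x' => g x' y := by
    filter_upwards [hU.mem_nhds hx] with x' hx' using h x' hx' y hy
  simp only [pdx, this.fderiv_eq]

theorem pdy_congr {U : Set (Vec n)} {f g : Vec n → Vec n → ℝ}
    (h : ∀ x ∈ U, ∀ y, y ≠ 0 → f x y = g x y) (k : Fin n) :
    ∀ x ∈ U, ∀ y, y ≠ 0 → pdy f k x y = pdy g k x y := by
  intro x hx y hy
  have : (fun y' => f x y') =ᶠ[nhds y] fun y' => g x y' := by
    filter_upwards [isOpen_ne.mem_nhds hy] with y' hy' using h x hx y' hy'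
  simp only [pdy, this.fderiv_eq]

namespace SmoothOffZero

variable {U : Set (Vec n)} {f g : Vec n → Vec n → ℝ}

theorem congr (hf : SmoothOffZero U f) (h : ∀ x ∈ U, ∀ y, y ≠ 0 → g x y = f x y) :
    SmoothOffZero U g :=
  ContDiffOn.congr hf fun p hp => h p.1 hp.1 p.2 hp.2

theorem contDiffAt (hU : IsOpen U) (hf : SmoothOffZero U f) {x y : Vec n}
    (hx : x ∈ U) (hy : y ≠ 0) :
    ContDiffAt ℝ (⊤ : ℕ∞) (fun p : Vec n × Vec n => f p.1 p.2) (x, y) :=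
  ContDiffOn.contDiffAt hf ((isOpen_prod_ne_zero hU).mem_nhds ⟨hx, hy⟩)

theorem differentiableAt (hU : IsOpen U) (hf : SmoothOffZero U f) {x y : Vec n}
    (hx : x ∈ U) (hy : y ≠ 0) :
    DifferentiableAt ℝ (fun p : Vec n × Vec n => f p.1 p.2) (x, y) :=
  (hf.contDiffAt hU hx hy).differentiableAt (by simp)

theorem differentiableAt_left (hU : IsOpen U) (hf : SmoothOffZero U f) {x y : Vec n}
    (hx : x ∈ U) (hy : y ≠ 0) : DifferentiableAt ℝ (fun x' => f x' y) x :=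
  (hf.differentiableAt hU hx hy).comp x (f := fun x' => (x', y)) (by fun_prop)

theorem differentiableAt_right (hU : IsOpen U) (hf : SmoothOffZero U f) {x y : Vec n}
    (hx : x ∈ U) (hy : y ≠ 0) : DifferentiableAt ℝ (fun y' => f x y') y :=
  (hf.differentiableAt hU hx hy).comp y (f := fun y' => (x, y')) (by fun_prop)

theorem pdx_eq_fderiv (hU : IsOpen U) (hf : SmoothOffZero U f) (k : Fin n) {x y : Vec n}
    (hx : x ∈ U) (hy : y ≠ 0) :
    pdx f k x y = fderiv ℝ (fun p : Vec n × Vec n => f p.1 p.2) (x, y) (Pi.single k 1, 0) := by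
  have h : HasFDerivAt (fun x' => f x' y) _ x :=
    HasFDerivAt.comp x (f := fun x' => (x', y)) (hf.differentiableAt hU hx hy).hasFDerivAt
      (hasFDerivAt_prodMk_left x y)
  simp [_root_.pdx, h.fderiv]

theorem pdy_eq_fderiv (hU : IsOpen U) (hf : SmoothOffZero U f) (k : Fin n) {x y : Vec n}
    (hx : x ∈ U) (hy : y ≠ 0) :
    pdy f k x y = fderiv ℝ (fun p : Vec n × Vec n => f p.1 p.2) (x, y) (0, Pi.single k 1) := by
  have h : HasFDerivAt (fun y' => f x y') _ y :=
    HasFDerivAt.comp y (f := fun y' => (x, y')) (hf.differentiableAt hU hx hy).hasFDerivAt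
      (hasFDerivAt_prodMk_right x y)
  simp [_root_.pdy, h.fderiv]

theorem fderiv_apply (hU : IsOpen U) (hf : SmoothOffZero U f) (v : Vec n × Vec n) :
    SmoothOffZero U fun x y => fderiv ℝ (fun p : Vec n × Vec n => f p.1 p.2) (x, y) v :=
  (ContDiffOn.fderiv_of_isOpen hf (isOpen_prod_ne_zero hU) (m := (⊤ : ℕ∞)) (by simp)).clm_apply
    contDiffOn_const

theorem pdx (hU : IsOpen U) (hf : SmoothOffZero U f) (k : Fin n) : SmoothOffZero U (pdx f k) :=
  (hf.fderiv_apply hU _).congr fun _ hx _ hy => hf.pdx_eq_fderiv hU k hx hy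

theorem pdy (hU : IsOpen U) (hf : SmoothOffZero U f) (k : Fin n) : SmoothOffZero U (pdy f k) :=
  (hf.fderiv_apply hU _).congr fun _ hx _ hy => hf.pdy_eq_fderiv hU k hx hy

theorem fderiv_fderiv_comm (hU : IsOpen U) (hf : SmoothOffZero U f) (v w : Vec n × Vec n)
    {x y : Vec n} (hx : x ∈ U) (hy : y ≠ 0) :
    fderiv ℝ (fun q => fderiv ℝ (fun p : Vec n × Vec n => f p.1 p.2) q v) (x, y) w =
      fderiv ℝ (fun q => fderiv ℝ (fun p : Vec n × Vec n => f p.1 p.2) q w) (x, y) v := by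
  have hc := hf.contDiffAt hU hx hy
  have hd : DifferentiableAt ℝ (fderiv ℝ (fun p : Vec n × Vec n => f p.1 p.2)) (x, y) :=
    (hc.fderiv_right (m := 1) (by norm_cast)).differentiableAt (by simp)
  rw [fderiv_clm_apply hd (by fun_prop), fderiv_clm_apply hd (by fun_prop)]
  have hs : IsSymmSndFDerivAt ℝ (fun p : Vec n × Vec n => f p.1 p.2) (x, y) :=
    hc.isSymmSndFDerivAt (by simp; norm_cast)
  simpa using hs w v

theorem pdy_pdx_comm (hU : IsOpen U) (hf : SmoothOffZero U f) (k m : Fin n) {x y : Vec n}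
    (hx : x ∈ U) (hy : y ≠ 0) :
    _root_.pdy (_root_.pdx f k) m x y = _root_.pdx (_root_.pdy f m) k x y := by
  rw [pdy_congr (fun x hx y hy => hf.pdx_eq_fderiv hU k hx hy) m x hx y hy,
    pdx_congr hU (fun x hx y hy => hf.pdy_eq_fderiv hU m hx hy) k x hx y hy,
    (hf.fderiv_apply hU _).pdy_eq_fderiv hU m hx hy,
    (hf.fderiv_apply hU _).pdx_eq_fderiv hU k hx hy]
  exact hf.fderiv_fderiv_comm hU _ _ hx hy

theorem pdy_pdy_comm (hU : IsOpen U) (hf : SmoothOffZero U f) (k m : Fin n) {x y : Vec n}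
    (hx : x ∈ U) (hy : y ≠ 0) :
    _root_.pdy (_root_.pdy f k) m x y = _root_.pdy (_root_.pdy f m) k x y := by
  rw [pdy_congr (fun x hx y hy => hf.pdy_eq_fderiv hU k hx hy) m x hx y hy,
    pdy_congr (fun x hx y hy => hf.pdy_eq_fderiv hU m hx hy) k x hx y hy,
    (hf.fderiv_apply hU _).pdy_eq_fderiv hU m hx hy,
    (hf.fderiv_apply hU _).pdy_eq_fderiv hU k hx hy]
  exact hf.fderiv_fderiv_comm hU _ _ hx hy

theorem add (hf : SmoothOffZero U f) (hg : SmoothOffZero U g) :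
    SmoothOffZero U fun x y => f x y + g x y :=
  ContDiffOn.add hf hg

theorem sub (hf : SmoothOffZero U f) (hg : SmoothOffZero U g) :
    SmoothOffZero U fun x y => f x y - g x y :=
  ContDiffOn.sub hf hg

theorem mul (hf : SmoothOffZero U f) (hg : SmoothOffZero U g) :
    SmoothOffZero U fun x y => f x y * g x y :=
  ContDiffOn.mul hf hg

theorem sum {ι : Type*} {s : Finset ι} {F : ι → Vec n → Vec n → ℝ}
    (hF : ∀ i ∈ s, SmoothOffZero U (F i)) : SmoothOffZero U fun x y => ∑ i ∈ s, F i x y :=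
  ContDiffOn.sum hF

theorem const (c : ℝ) : SmoothOffZero U fun _ _ => c :=
  contDiffOn_const

theorem coord (j : Fin n) : SmoothOffZero U fun _ y => y j := by
  unfold SmoothOffZero
  fun_prop

theorem of_base {h : Vec n → ℝ} (hh : ContDiffOn ℝ (⊤ : ℕ∞) h U) :
    SmoothOffZero U fun x _ => h x :=
  hh.comp contDiffOn_fst fun _ hp => hp.1

theorem pdy_add (hU : IsOpen U) (hf : SmoothOffZero U f) (hg : SmoothOffZero U g) (k : Fin n)
    {x y : Vec n} (hx : x ∈ U) (hy : y ≠ 0) :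
    _root_.pdy (fun x y => f x y + g x y) k x y = _root_.pdy f k x y + _root_.pdy g k x y := by
  simp only [_root_.pdy]
  rw [fderiv_fun_add (hf.differentiableAt_right hU hx hy) (hg.differentiableAt_right hU hx hy)]
  simp

theorem pdy_sub (hU : IsOpen U) (hf : SmoothOffZero U f) (hg : SmoothOffZero U g) (k : Fin n)
    {x y : Vec n} (hx : x ∈ U) (hy : y ≠ 0) :
    _root_.pdy (fun x y => f x y - g x y) k x y = _root_.pdy f k x y - _root_.pdy g k x y := by
  simp only [_root_.pdy]
  rw [fderiv_fun_sub (hf.differentiableAt_right hU hx hy) (hg.differentiableAt_right hU hx hy)]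
  simp

theorem pdy_mul (hU : IsOpen U) (hf : SmoothOffZero U f) (hg : SmoothOffZero U g) (k : Fin n)
    {x y : Vec n} (hx : x ∈ U) (hy : y ≠ 0) :
    _root_.pdy (fun x y => f x y * g x y) k x y =
      _root_.pdy f k x y * g x y + f x y * _root_.pdy g k x y := by
  simp only [_root_.pdy]
  rw [fderiv_fun_mul (hf.differentiableAt_right hU hx hy) (hg.differentiableAt_right hU hx hy)]
  simp only [add_apply, smul_apply, smul_eq_mul]
  ring

theorem pdx_mul (hU : IsOpen U) (hf : SmoothOffZero U f) (hg : SmoothOffZero U g) (k : Fin n)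
    {x y : Vec n} (hx : x ∈ U) (hy : y ≠ 0) :
    _root_.pdx (fun x y => f x y * g x y) k x y =
      _root_.pdx f k x y * g x y + f x y * _root_.pdx g k x y := by
  simp only [_root_.pdx]
  rw [fderiv_fun_mul (hf.differentiableAt_left hU hx hy) (hg.differentiableAt_left hU hx hy)]
  simp only [add_apply, smul_apply, smul_eq_mul]
  ring

theorem pdy_sum (hU : IsOpen U) {ι : Type*} {s : Finset ι} {F : ι → Vec n → Vec n → ℝ}
    (hF : ∀ i ∈ s, SmoothOffZero U (F i)) (k : Fin n) {x y : Vec n} (hx : x ∈ U) (hy : y ≠ 0) :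
    _root_.pdy (fun x y => ∑ i ∈ s, F i x y) k x y = ∑ i ∈ s, _root_.pdy (F i) k x y := by
  simp only [_root_.pdy]
  rw [fderiv_fun_sum fun i hi => (hF i hi).differentiableAt_right hU hx hy]
  simp

theorem pdx_sum (hU : IsOpen U) {ι : Type*} {s : Finset ι} {F : ι → Vec n → Vec n → ℝ}
    (hF : ∀ i ∈ s, SmoothOffZero U (F i)) (k : Fin n) {x y : Vec n} (hx : x ∈ U) (hy : y ≠ 0) :
    _root_.pdx (fun x y => ∑ i ∈ s, F i x y) k x y = ∑ i ∈ s, _root_.pdx (F i) k x y := by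
  simp only [_root_.pdx]
  rw [fderiv_fun_sum fun i hi => (hF i hi).differentiableAt_left hU hx hy]
  simp

end SmoothOffZero

@[simp] theorem pdy_const_mul (c : ℝ) (f : Vec n → Vec n → ℝ) (k : Fin n) (x y : Vec n) :
    pdy (fun x y => c * f x y) k x y = c * pdy f k x y :=
  DFunLike.congr_fun
    (congr_fun (fderiv_const_smul_field (𝕜 := ℝ) (f := fun y' => f x y') c) y) (Pi.single k 1)

@[simp] theorem pdx_const_mul (c : ℝ) (f : Vec n → Vec n → ℝ) (k : Fin n) (x y : Vec n) :
    pdx (fun x y => c * f x y) k x y = c * pdx f k x y :=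
  DFunLike.congr_fun
    (congr_fun (fderiv_const_smul_field (𝕜 := ℝ) (f := fun x' => f x' y) c) x) (Pi.single k 1)

@[simp] theorem pdy_coord (j k : Fin n) (x y : Vec n) :
    pdy (fun _ y => y j) k x y = if j = k then 1 else 0 := by
  simp [pdy, fderiv_apply, Pi.single_apply]

@[simp] theorem pdx_coord (j k : Fin n) (x y : Vec n) :
    pdx (fun _ y => y j) k x y = 0 := by
  simp [pdx]

@[simp] theorem pdy_base (h : Vec n → ℝ) (k : Fin n) (x y : Vec n) :
    pdy (fun x _ => h x) k x y = 0 := by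
  simp [pdy]

section Contraction

variable {U : Set (Vec n)} {F : Fin n → Vec n → Vec n → ℝ} {g : Vec n → Vec n → ℝ}

theorem sum_coord_mul_pdx (hU : IsOpen U) (hF : ∀ j, SmoothOffZero U (F j))
    (h : ∀ x ∈ U, ∀ y, y ≠ 0 → ∑ j, y j * F j x y = g x y) (k : Fin n) :
    ∀ x ∈ U, ∀ y, y ≠ 0 → ∑ j, y j * pdx (F j) k x y = pdx g k x y := by
  intro x hx y hy
  rw [← pdx_congr hU h k x hx y hy,
    SmoothOffZero.pdx_sum hU (fun j _ => (SmoothOffZero.coord j).mul (hF j)) k hx hy]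
  refine Finset.sum_congr rfl fun j _ => ?_
  rw [SmoothOffZero.pdx_mul hU (SmoothOffZero.coord j) (hF j) k hx hy]
  simp

theorem sum_coord_mul_pdy (hU : IsOpen U) (hF : ∀ j, SmoothOffZero U (F j))
    (h : ∀ x ∈ U, ∀ y, y ≠ 0 → ∑ j, y j * F j x y = g x y) (k : Fin n) :
    ∀ x ∈ U, ∀ y, y ≠ 0 → F k x y + ∑ j, y j * pdy (F j) k x y = pdy g k x y := by
  intro x hx y hy
  rw [← pdy_congr h k x hx y hy,
    SmoothOffZero.pdy_sum hU (fun j _ => (SmoothOffZero.coord j).mul (hF j)) k hx hy]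
  simp_rw [fun j => SmoothOffZero.pdy_mul hU (SmoothOffZero.coord j) (hF j) k hx hy]
  simp [Finset.sum_add_distrib]

end Contraction

theorem sum_mul_sum_mul_comm {ι κ : Type*} [Fintype ι] [Fintype κ] (a : ι → ℝ) (c : κ → ℝ)
    (H : κ → ι → ℝ) : ∑ l, a l * ∑ s, c s * H s l = ∑ s, c s * ∑ l, a l * H s l := by
  simp only [Finset.mul_sum]
  rw [Finset.sum_comm]
  simp only [mul_left_comm]

namespace IsSpray

variable {U : Set (Vec n)} {G : Fin n → Vec n → Vec n → ℝ}

theorem smooth (hG : IsSpray U G) (i : Fin n) : SmoothOffZero U (G i) := hG.1 i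

theorem smooth_Nc (hU : IsOpen U) (hG : IsSpray U G) (i j : Fin n) : SmoothOffZero U (Nc G i j) :=
  (hG.smooth i).pdy hU j

theorem smooth_Ga (hU : IsOpen U) (hG : IsSpray U G) (i j k : Fin n) :
    SmoothOffZero U (Ga G i j k) :=
  (hG.smooth_Nc hU i j).pdy hU k

theorem Ga_symm (hU : IsOpen U) (hG : IsSpray U G) (i j k : Fin n) :
    ∀ x ∈ U, ∀ y, y ≠ 0 → Ga G i j k x y = Ga G i k j x y :=
  fun _ hx _ hy => (hG.smooth i).pdy_pdy_comm hU j k hx hy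

theorem sum_coord_mul_Nc (hU : IsOpen U) (hG : IsSpray U G) (i : Fin n) :
    ∀ x ∈ U, ∀ y, y ≠ 0 → ∑ j, y j * Nc G i j x y = 2 * G i x y := by
  intro x hx y hy
  have hd := ((hG.smooth i).differentiableAt_right hU hx hy).hasFDerivAt
  have hs : HasDerivAt (fun t : ℝ => t • y) y 1 := by
    simpa using (hasDerivAt_id (1 : ℝ)).smul_const y
  have h1 : HasDerivAt (fun t : ℝ => G i x (t • y)) (fderiv ℝ (fun y' => G i x y') y y) 1 :=
    HasFDerivAt.comp_hasDerivAt (1 : ℝ) (by simpa using hd) hs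
  have h2 : HasDerivAt (fun t : ℝ => t ^ 2 * G i x y) (2 * G i x y) 1 := by
    simpa using (hasDerivAt_pow 2 (1 : ℝ)).mul_const (G i x y)
  have he : (fun t : ℝ => G i x (t • y)) =ᶠ[nhds 1] fun t => t ^ 2 * G i x y := by
    filter_upwards [lt_mem_nhds (zero_lt_one (α := ℝ))] with t ht using hG.2 i x y t ht
  rw [← h1.unique (h2.congr_of_eventuallyEq he)]
  conv_rhs => enter [2]; rw [pi_eq_sum_univ' y]
  simp [Nc, pdy]

theorem sum_coord_mul_Ga (hU : IsOpen U) (hG : IsSpray U G) (i k : Fin n) :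
    ∀ x ∈ U, ∀ y, y ≠ 0 → ∑ j, y j * Ga G i j k x y = Nc G i k x y := by
  intro x hx y hy
  have h := sum_coord_mul_pdy hU (hG.smooth_Nc hU i) (hG.sum_coord_mul_Nc hU i) k x hx y hy
  rw [pdy_const_mul] at h
  simp only [Ga]
  have : pdy (G i) k x y = Nc G i k x y := rfl
  linarith

theorem sum_coord_mul_pdy_Ga (hU : IsOpen U) (hG : IsSpray U G) (i k m : Fin n) :
    ∀ x ∈ U, ∀ y, y ≠ 0 → ∑ j, y j * pdy (Ga G i j k) m x y = 0 := by
  intro x hx y hy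
  have h := sum_coord_mul_pdy hU (fun j => hG.smooth_Ga hU i j k) (hG.sum_coord_mul_Ga hU i k)
    m x hx y hy
  rw [hG.Ga_symm hU i m k x hx y hy] at h
  simpa [Ga] using h

theorem sum_coord_mul_hd_Ga (hU : IsOpen U) (hG : IsSpray U G) (i k l : Fin n) :
    ∀ x ∈ U, ∀ y, y ≠ 0 → ∑ j, y j * hd G (Ga G i j l) k x y = pdx (Nc G i l) k x y := by
  intro x hx y hy
  simp only [hd, mul_sub, Finset.sum_sub_distrib]
  rw [sum_coord_mul_pdx hU (fun j => hG.smooth_Ga hU i j l) (hG.sum_coord_mul_Ga hU i l)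
    k x hx y hy]
  simp only [sum_mul_sum_mul_comm, hG.sum_coord_mul_pdy_Ga hU i l _ x hx y hy]
  simp

theorem sum_coord_mul_Riem4 (hU : IsOpen U) (hG : IsSpray U G) (i k l : Fin n) :
    ∀ x ∈ U, ∀ y, y ≠ 0 → ∑ j, y j * Riem4 G j i k l x y =
      pdx (Nc G i l) k x y - pdx (Nc G i k) l x y +
        ∑ s, (Ga G i k s x y * Nc G s l x y - Nc G s k x y * Ga G i l s x y) := by
  intro x hx y hy
  simp only [Riem4, mul_sub, mul_add, Finset.sum_sub_distrib, Finset.sum_add_distrib]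
  rw [hG.sum_coord_mul_hd_Ga hU i k l x hx y hy, hG.sum_coord_mul_hd_Ga hU i l k x hx y hy]
  simp only [← hG.sum_coord_mul_Ga hU _ _ x hx y hy, Finset.mul_sum, Finset.sum_mul]
  congr 2
  · rw [Finset.sum_comm]
    exact Finset.sum_congr rfl fun _ _ => Finset.sum_congr rfl fun _ _ => by ring
  · rw [Finset.sum_comm]
    exact Finset.sum_congr rfl fun _ _ => Finset.sum_congr rfl fun _ _ => by ring

/-- The coordinate formula for the Riemann curvature in terms of the spray coefficients. -/
theorem Riem2_eq (hU : IsOpen U) (hG : IsSpray U G) (i k : Fin n) :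
    ∀ x ∈ U, ∀ y, y ≠ 0 → Riem2 G i k x y =
      2 * pdx (G i) k x y - ∑ j, y j * pdx (Nc G i k) j x y +
        2 * ∑ j, G j x y * Ga G i j k x y - ∑ j, Nc G i j x y * Nc G j k x y := by
  intro x hx y hy
  have h1 : Riem2 G i k x y = ∑ l, y l * ∑ j, y j * Riem4 G j i k l x y := by
    simp only [Riem2, Finset.mul_sum]
    rw [Finset.sum_comm]
    exact Finset.sum_congr rfl fun _ _ => Finset.sum_congr rfl fun _ _ => by ring
  have h2 := sum_coord_mul_pdx hU (hG.smooth_Nc hU i) (hG.sum_coord_mul_Nc hU i) k x hx y hy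
  have h3 : ∑ l, y l * ∑ s, Ga G i k s x y * Nc G s l x y =
      2 * ∑ s, G s x y * Ga G i s k x y := by
    rw [sum_mul_sum_mul_comm, Finset.mul_sum]
    refine Finset.sum_congr rfl fun s _ => ?_
    rw [hG.sum_coord_mul_Nc hU s x hx y hy, hG.Ga_symm hU i k s x hx y hy]
    ring
  have h4 : ∑ l, y l * ∑ s, Nc G s k x y * Ga G i l s x y =
      ∑ s, Nc G i s x y * Nc G s k x y := by
    rw [sum_mul_sum_mul_comm]
    refine Finset.sum_congr rfl fun s _ => ?_
    rw [hG.sum_coord_mul_Ga hU i s x hx y hy, mul_comm]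
  rw [h1]
  simp only [hG.sum_coord_mul_Riem4 hU i k _ x hx y hy, mul_add, mul_sub,
    Finset.sum_add_distrib, Finset.sum_sub_distrib, h2, h3, h4, pdx_const_mul]
  ring

theorem pdy_Riem2 (hU : IsOpen U) (hG : IsSpray U G) (i k m : Fin n) :
    ∀ x ∈ U, ∀ y, y ≠ 0 → pdy (Riem2 G i k) m x y =
      2 * pdx (Nc G i m) k x y
        - (pdx (Nc G i k) m x y + ∑ j, y j * pdx (Ga G i k m) j x y)
        + 2 * ∑ j, (Nc G j m x y * Ga G i j k x y + G j x y * pdy (Ga G i j k) m x y)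
        - ∑ j, (Ga G i j m x y * Nc G j k x y + Nc G i j x y * Ga G j k m x y) := by
  intro x hx y hy
  have sN := hG.smooth_Nc hU
  have sΓ := hG.smooth_Ga hU
  have s1 : SmoothOffZero U fun x y => 2 * pdx (G i) k x y :=
    (SmoothOffZero.const 2).mul ((hG.smooth i).pdx hU k)
  have s2 (j : Fin n) : SmoothOffZero U fun x y => y j * pdx (Nc G i k) j x y :=
    (SmoothOffZero.coord j).mul ((sN i k).pdx hU j)
  have s3 (j : Fin n) : SmoothOffZero U fun x y => G j x y * Ga G i j k x y :=
    (hG.smooth j).mul (sΓ i j k)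
  have s4 (j : Fin n) : SmoothOffZero U fun x y => Nc G i j x y * Nc G j k x y :=
    (sN i j).mul (sN j k)
  have s2' := SmoothOffZero.sum (s := Finset.univ) fun j _ => s2 j
  have s3' := (SmoothOffZero.const 2).mul (SmoothOffZero.sum (s := Finset.univ) fun j _ => s3 j)
  have s4' := SmoothOffZero.sum (s := Finset.univ) fun j _ => s4 j
  rw [pdy_congr (hG.Riem2_eq hU i k) m x hx y hy,
    SmoothOffZero.pdy_sub hU ((s1.sub s2').add s3') s4' m hx hy,
    SmoothOffZero.pdy_add hU (s1.sub s2') s3' m hx hy,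
    SmoothOffZero.pdy_sub hU s1 s2' m hx hy, pdy_const_mul, pdy_const_mul,
    SmoothOffZero.pdy_sum hU (fun j _ => s2 j) m hx hy,
    SmoothOffZero.pdy_sum hU (fun j _ => s3 j) m hx hy,
    SmoothOffZero.pdy_sum hU (fun j _ => s4 j) m hx hy,
    (hG.smooth i).pdy_pdx_comm hU k m hx hy]
  simp_rw [fun j => SmoothOffZero.pdy_mul hU (SmoothOffZero.coord j) ((sN i k).pdx hU j) m hx hy,
    fun j => SmoothOffZero.pdy_mul hU (hG.smooth j) (sΓ i j k) m hx hy,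
    fun j => SmoothOffZero.pdy_mul hU (sN i j) (sN j k) m hx hy,
    fun j => (sN i k).pdy_pdx_comm hU j m hx hy]
  simp only [pdy_coord, ite_mul, one_mul, zero_mul, Finset.sum_add_distrib, Finset.sum_ite_eq',
    Finset.mem_univ, if_true]
  rfl

/-- The χ-curvature of a spray in terms of `Π`. -/
theorem chi_eq (hU : IsOpen U) (hG : IsSpray U G) (k : Fin n) :
    ∀ x ∈ U, ∀ y, y ≠ 0 → chi G k x y =
      -(1 / 2) * (pdx (PiG G) k x y - ∑ j, y j * pdx (pdy (PiG G) k) j x y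
        + 2 * ∑ j, G j x y * pdy (pdy (PiG G) j) k x y) := by
  intro x hx y hy
  have sN := hG.smooth_Nc hU
  have sΓ := hG.smooth_Ga hU
  have hPi (k : Fin n) : ∀ x ∈ U, ∀ y, y ≠ 0 → pdy (PiG G) k x y = ∑ m, Ga G m m k x y :=
    fun x hx y hy => SmoothOffZero.pdy_sum hU (fun m _ => sN m m) k hx hy
  have hA : pdx (PiG G) k x y = ∑ m, pdx (Nc G m m) k x y :=
    SmoothOffZero.pdx_sum hU (fun m _ => sN m m) k hx hy
  have hC (j : Fin n) : pdx (pdy (PiG G) k) j x y = ∑ m, pdx (Ga G m m k) j x y := by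
    rw [pdx_congr hU (hPi k) j x hx y hy]
    exact SmoothOffZero.pdx_sum hU (fun m _ => sΓ m m k) j hx hy
  have hD (j : Fin n) : pdy (pdy (PiG G) j) k x y = ∑ m, pdy (Ga G m m j) k x y := by
    rw [pdy_congr (hPi j) k x hx y hy]
    exact SmoothOffZero.pdy_sum hU (fun m _ => sΓ m m j) k hx hy
  have hΓx (m j : Fin n) : pdx (Ga G m k m) j x y = pdx (Ga G m m k) j x y :=
    pdx_congr hU (hG.Ga_symm hU m k m) j x hx y hy
  have hΓy (m j : Fin n) : pdy (Ga G m j m) k x y = pdy (Ga G m m j) k x y :=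
    pdy_congr (hG.Ga_symm hU m j m) k x hx y hy
  have hΓy' (m j : Fin n) : pdy (Ga G m j k) m x y = pdy (Ga G m m j) k x y := by
    rw [← hΓy]
    exact (sN m j).pdy_pdy_comm hU k m hx hy
  have hE : ∑ m, ∑ j, Nc G m j x y * Ga G j k m x y = ∑ m, ∑ j, Nc G j m x y * Ga G m j k x y := by
    rw [Finset.sum_comm]
    refine Finset.sum_congr rfl fun m _ => Finset.sum_congr rfl fun j _ => ?_
    rw [hG.Ga_symm hU m k j x hx y hy]
  have hE' : ∑ m, ∑ j, Nc G m j x y * Ga G j m k x y = ∑ m, ∑ j, Nc G j m x y * Ga G m j k x y :=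
    Finset.sum_comm
  have hE'' : ∑ m, ∑ j, Ga G m j k x y * Nc G j m x y =
      ∑ m, ∑ j, Nc G j m x y * Ga G m j k x y := by
    simp only [mul_comm]
  have hF : ∑ m, ∑ j, Nc G j k x y * Ga G m j m x y = ∑ m, ∑ j, Ga G m j m x y * Nc G j k x y := by
    simp only [mul_comm]
  have hC' : ∑ j, y j * ∑ m, pdx (Ga G m m k) j x y =
      ∑ m, ∑ j, y j * pdx (Ga G m m k) j x y := by
    simp only [Finset.mul_sum]
    exact Finset.sum_comm
  have hD' : ∑ j, G j x y * ∑ m, pdy (Ga G m m j) k x y =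
      ∑ m, ∑ j, G j x y * pdy (Ga G m m j) k x y := by
    simp only [Finset.mul_sum]
    exact Finset.sum_comm
  simp only [chi, hG.pdy_Riem2 hU _ _ _ x hx y hy, hΓx, hΓy, hΓy', hA, hC, hD,
    Finset.sum_add_distrib, Finset.sum_sub_distrib, ← Finset.mul_sum, hE, hE', hE'', hF, hC', hD']
  ring

end IsSpray

/-- an S-closed spray (i.e. `Π = η_k(x) y^k` with `η` a closed `1`-form) has
vanishing χ-curvature. -/
theorem chi_zero_of_S_closed
    {n : ℕ} (hn : 2 ≤ n) (U : Set (Vec n)) (hU : IsOpen U)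
    (G : Fin n → Vec n → Vec n → ℝ) (hG : IsSpray U G)
    (η : Fin n → Vec n → ℝ)
    (hηsm : ∀ k, ContDiffOn ℝ (⊤ : ℕ∞) (η k) U)
    (hPi : ∀ x ∈ U, ∀ y : Vec n, y ≠ 0 → PiG G x y = ∑ k, η k x * y k)
    (hclosed : ∀ x ∈ U, ∀ k l, pd (η k) l x = pd (η l) k x) :
    ∀ x ∈ U, ∀ y : Vec n, y ≠ 0 → ∀ k, chi G k x y = 0 := by
  intro x hx y hy k
  have sη (j : Fin n) := SmoothOffZero.of_base (hηsm j)
  have hx1 (k : Fin n) : pdx (PiG G) k x y = ∑ j, y j * pd (η j) k x := by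
    rw [← sum_coord_mul_pdx hU sη (fun x hx y hy => by
      rw [hPi x hx y hy]; exact Finset.sum_congr rfl fun _ _ => mul_comm _ _) k x hx y hy]
    rfl
  have hy1 (k : Fin n) : ∀ x ∈ U, ∀ y, y ≠ 0 → pdy (PiG G) k x y = η k x := by
    intro x hx y hy
    rw [← sum_coord_mul_pdy hU sη (fun x hx y hy => by
      rw [hPi x hx y hy]; exact Finset.sum_congr rfl fun _ _ => mul_comm _ _) k x hx y hy]
    simp
  have hyx (j : Fin n) : pdx (pdy (PiG G) k) j x y = pd (η j) k x := by
    rw [pdx_congr hU (hy1 k) j x hx y hy, hclosed x hx j k]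
    rfl
  have hyy (j : Fin n) : pdy (pdy (PiG G) j) k x y = 0 := by
    rw [pdy_congr (hy1 j) k x hx y hy, pdy_base]
  simp [hG.chi_eq hU k x hx y hy, hx1, hyx, hyy]
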